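/- Let E be a module over O₀ which is finite-dimensional as a ℂ-vector space (with compatible ℂ-action). Then for every ℂ-linear functional η on End_ℂ(E) there exists a finitely supported family c : (Fin n →₀ ℕ) →₀ ℂ such that for every open set Ω ⊆ ℂⁿ, every function f : ℂⁿ → ℂ analytic at each point of Ω, and every μ ∈ Ω: η(f^{(E)}(μ)) = Σ_α c_α · (∂^α f)(μ), where ∂^α f denotes the iterated partial derivative of f along coordinate directions. -/

import Mathlib

open Filter Topology

noncomputable section

namespace PaleyWiener

/-- The `ℂ`-algebra structure on germs of `ℂ`-valued functions, via constant germs. -/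
instance germAlgebra {α : Type*} {l : Filter α} : Algebra ℂ (Filter.Germ l ℂ) :=
  Algebra.ofModule
    (fun c x y => by
      refine x.inductionOn fun f => y.inductionOn fun g => ?_
      rw [← Filter.Germ.coe_smul, ← Filter.Germ.coe_mul, ← Filter.Germ.coe_mul,
        ← Filter.Germ.coe_smul, smul_mul_assoc])
    (fun c x y => by
      refine x.inductionOn fun f => y.inductionOn fun g => ?_
      rw [← Filter.Germ.coe_smul, ← Filter.Germ.coe_mul, ← Filter.Germ.coe_mul,
        ← Filter.Germ.coe_smul, mul_smul_comm])

variable (n : ℕ)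

/-- The ring of germs at `0` of holomorphic functions on `ℂⁿ`, realized as the subalgebra of
`Filter.Germ (𝓝 0) ℂ` of germs admitting a representative analytic at `0`. -/
def O0 : Subalgebra ℂ (Filter.Germ (𝓝 (0 : Fin n → ℂ)) ℂ) where
  carrier := {g | ∃ f : (Fin n → ℂ) → ℂ, AnalyticAt ℂ f 0 ∧ g = ↑f}
  mul_mem' := by
    rintro a b ⟨f, hf, rfl⟩ ⟨g, hg, rfl⟩
    exact ⟨f * g, hf.mul hg, rfl⟩
  add_mem' := by
    rintro a b ⟨f, hf, rfl⟩ ⟨g, hg, rfl⟩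
    exact ⟨f + g, hf.add hg, rfl⟩
  algebraMap_mem' := fun c => ⟨fun _ => c, analyticAt_const, by
    rw [Algebra.algebraMap_eq_smul_one]
    have h : ((fun _ : Fin n → ℂ => c) : (Fin n → ℂ) → ℂ) = c • (1 : (Fin n → ℂ) → ℂ) := by
      funext x; simp
    rw [h, Filter.Germ.coe_smul, Filter.Germ.coe_one]⟩

/-- Evaluation at `0` of a germ at `𝓝 0`, as a ring homomorphism; this is well defined
since every neighborhood of `0` contains `0`. -/
def germEval0 : Filter.Germ (𝓝 (0 : Fin n → ℂ)) ℂ →+* ℂ where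
  toFun g := g.liftOn (fun f => f 0) fun _ _ h => h.self_of_nhds
  map_one' := rfl
  map_mul' a b := a.inductionOn₂ b fun _ _ => rfl
  map_zero' := rfl
  map_add' a b := a.inductionOn₂ b fun _ _ => rfl

/-- Evaluation at `0` on `O₀`. -/
def evalO0 : O0 n →+* ℂ := (germEval0 n).comp ((O0 n).val : O0 n →ₐ[ℂ] _).toRingHom

/-- The maximal ideal `M` of `O₀`, consisting of the germs vanishing at `0`. -/
def Mideal : Ideal (O0 n) := RingHom.ker (evalO0 n)

end PaleyWiener

namespace PaleyWiener

/-- The partial derivative of `f : ℂⁿ → ℂ` in the `i`-th coordinate direction. -/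
def pdi (n : ℕ) (i : Fin n) (f : (Fin n → ℂ) → ℂ) : (Fin n → ℂ) → ℂ :=
  fun x => fderiv ℂ f x (Pi.single i 1)

/-- The iterated partial derivative `∂^α f` of `f : ℂⁿ → ℂ` along the coordinate directions,
for a multi-index `α`. -/
def pdMulti (n : ℕ) (α : Fin n →₀ ℕ) (f : (Fin n → ℂ) → ℂ) : (Fin n → ℂ) → ℂ :=
  (List.finRange n).foldr (fun i g => (pdi n i)^[α i] g) f

/-- The germ at `0` of `λ ↦ f (μ + λ)`, for `f` analytic at `μ`, as an element of `O₀`. -/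
def shiftGerm (n : ℕ) (μ : Fin n → ℂ) (f : (Fin n → ℂ) → ℂ) (hf : AnalyticAt ℂ f μ) :
    O0 n :=
  ⟨(↑(fun t : Fin n → ℂ => f (μ + t)) : Filter.Germ (nhds (0 : Fin n → ℂ)) ℂ),
    fun t : Fin n → ℂ => f (μ + t), by
      have h1 : AnalyticAt ℂ (fun t : Fin n → ℂ => μ + t) 0 :=
        analyticAt_const.add analyticAt_id
      have h2 : AnalyticAt ℂ f ((fun t : Fin n → ℂ => μ + t) 0) := by simpa using hf
      exact h2.comp h1, rfl⟩

/-- For an `O₀`-module `E`, an open `Ω ⊆ ℂⁿ`, `f` analytic on `Ω` and `μ ∈ Ω`, the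
endomorphism `f^{(E)}(μ) ∈ End_ℂ(E)`, given by `e ↦ g • e` where `g ∈ O₀` is the germ at `0`
of `λ ↦ f(μ + λ)`. -/
def fE (n : ℕ) (E : Type*) [AddCommGroup E] [Module ℂ E] [Module (O0 n) E]
    [IsScalarTower ℂ (O0 n) E] (μ : Fin n → ℂ) (f : (Fin n → ℂ) → ℂ)
    (hf : AnalyticAt ℂ f μ) : Module.End ℂ E where
  toFun e := shiftGerm n μ f hf • e
  map_add' x y := smul_add _ x y
  map_smul' c x := (smul_comm c (shiftGerm n μ f hf) x).symm

end PaleyWiener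

namespace PaleyWiener


/-- The element of `O₀` with analytic representative `f`. -/
def mkO (n : ℕ) (f : (Fin n → ℂ) → ℂ) (hf : AnalyticAt ℂ f 0) : O0 n :=
  ⟨(↑f : Filter.Germ (𝓝 (0 : Fin n → ℂ)) ℂ), f, hf, rfl⟩

theorem exists_mkO {n : ℕ} (g : O0 n) : ∃ f hf, g = mkO n f hf := by
  obtain ⟨g, f, hf, rfl⟩ := g
  exact ⟨f, hf, rfl⟩

theorem mkO_eq_iff {n : ℕ} {f g : (Fin n → ℂ) → ℂ} (hf : AnalyticAt ℂ f 0)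
    (hg : AnalyticAt ℂ g 0) : mkO n f hf = mkO n g hg ↔ f =ᶠ[𝓝 0] g := by
  exact Subtype.ext_iff.trans Filter.Germ.coe_eq

theorem mkO_add {n : ℕ} {f g : (Fin n → ℂ) → ℂ} (hf : AnalyticAt ℂ f 0)
    (hg : AnalyticAt ℂ g 0) : mkO n f hf + mkO n g hg = mkO n (f + g) (hf.add hg) := rfl

theorem mkO_mul {n : ℕ} {f g : (Fin n → ℂ) → ℂ} (hf : AnalyticAt ℂ f 0)
    (hg : AnalyticAt ℂ g 0) : mkO n f hf * mkO n g hg = mkO n (f * g) (hf.mul hg) := rfl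

theorem mkO_smul {n : ℕ} {f : (Fin n → ℂ) → ℂ} (c : ℂ) (hf : AnalyticAt ℂ f 0) :
    c • mkO n f hf = mkO n (c • f) (analyticAt_const.smul hf) := rfl

theorem mkO_one {n : ℕ} : (1 : O0 n) = mkO n (fun _ => 1) analyticAt_const := rfl

theorem evalO0_mkO {n : ℕ} {f : (Fin n → ℂ) → ℂ} (hf : AnalyticAt ℂ f 0) :
    evalO0 n (mkO n f hf) = f 0 := rfl

/-- Evaluation at `0` as a linear map. -/
def evL (n : ℕ) : O0 n →ₗ[ℂ] ℂ where
  toFun := evalO0 n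
  map_add' := map_add _
  map_smul' c g := by
    obtain ⟨f, hf, rfl⟩ := exists_mkO g
    rfl

theorem mem_Mideal {n : ℕ} {g : O0 n} : g ∈ Mideal n ↔ evalO0 n g = 0 := RingHom.mem_ker

theorem Mideal_le_jacobson (n : ℕ) : Mideal n ≤ Ideal.jacobson ⊥ := by
  intro g hg
  rw [Ideal.mem_jacobson_bot]
  intro y
  have h1 : evalO0 n (g * y + 1) = 1 := by
    rw [map_add, map_mul, mem_Mideal.1 hg, zero_mul, zero_add, map_one]
  obtain ⟨f, hf, hfe⟩ := exists_mkO (g * y + 1)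
  rw [hfe] at h1 ⊢
  rw [evalO0_mkO] at h1
  have h0 : f 0 ≠ 0 := by rw [h1]; exact one_ne_zero
  refine IsUnit.of_mul_eq_one (mkO n f⁻¹ (hf.inv h0)) ?_
  rw [mkO_mul, mkO_one, mkO_eq_iff]
  filter_upwards [hf.continuousAt.eventually_ne h0] with x hx
  simp [hx]

theorem pdi_analyticAt {n : ℕ} (i : Fin n) {f : (Fin n → ℂ) → ℂ} {x : Fin n → ℂ}
    (hf : AnalyticAt ℂ f x) : AnalyticAt ℂ (pdi n i f) x := by
  exact ((ContinuousLinearMap.apply ℂ ℂ (Pi.single i (1 : ℂ) : Fin n → ℂ)).analyticAt _).comp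
    hf.fderiv

theorem pdi_congr {n : ℕ} (i : Fin n) {f g : (Fin n → ℂ) → ℂ} {x : Fin n → ℂ}
    (h : f =ᶠ[𝓝 x] g) : pdi n i f =ᶠ[𝓝 x] pdi n i g := by
  filter_upwards [h.fderiv (𝕜 := ℂ)] with y hy
  simp only [pdi, hy]

theorem pdi_comm {n : ℕ} (i j : Fin n) {f : (Fin n → ℂ) → ℂ} {x : Fin n → ℂ}
    (hf : AnalyticAt ℂ f x) : pdi n i (pdi n j f) x = pdi n j (pdi n i f) x := by
  have key : ∀ i j : Fin n, pdi n i (pdi n j f) x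
      = fderiv ℂ (fderiv ℂ f) x (Pi.single i 1) (Pi.single j 1) := by
    intro i j
    have hd : DifferentiableAt ℂ (fderiv ℂ f) x := hf.fderiv.differentiableAt
    have := fderiv_clm_apply hd (differentiableAt_const (Pi.single j (1 : ℂ) : Fin n → ℂ))
    change fderiv ℂ (fun y => fderiv ℂ f y (Pi.single j 1)) x (Pi.single i 1) = _
    rw [this]
    simp
  rw [key, key]
  exact (hf.contDiffAt (n := ⊤)).isSymmSndFDerivAt le_top _ _

/-- The function underlying the derivation `∂_i` of `O₀`. -/
def dFun (n : ℕ) (i : Fin n) (g : O0 n) : O0 n :=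
  mkO n (pdi n i (exists_mkO g).choose) (pdi_analyticAt i (exists_mkO g).choose_spec.choose)

theorem dFun_mkO {n : ℕ} (i : Fin n) {f : (Fin n → ℂ) → ℂ} (hf : AnalyticAt ℂ f 0) :
    dFun n i (mkO n f hf) = mkO n (pdi n i f) (pdi_analyticAt i hf) := by
  unfold dFun
  rw [mkO_eq_iff]
  apply pdi_congr
  have h := (exists_mkO (mkO n f hf)).choose_spec.choose_spec
  exact ((mkO_eq_iff _ _).1 h).symm

/-- The derivation `∂_i` of `O₀`. -/
def dO (n : ℕ) (i : Fin n) : Derivation ℂ (O0 n) (O0 n) :=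
  Derivation.mk'
    { toFun := dFun n i
      map_add' := by
        intro a b
        obtain ⟨f, hf, rfl⟩ := exists_mkO a
        obtain ⟨g, hg, rfl⟩ := exists_mkO b
        rw [mkO_add, dFun_mkO, dFun_mkO, dFun_mkO, mkO_add, mkO_eq_iff]
        filter_upwards [hf.eventually_analyticAt, hg.eventually_analyticAt] with x h1 h2
        simp only [pdi, Pi.add_apply]
        rw [fderiv_add h1.differentiableAt h2.differentiableAt]
        rfl
      map_smul' := by
        intro c a
        obtain ⟨f, hf, rfl⟩ := exists_mkO a
        rw [mkO_smul, dFun_mkO, dFun_mkO, RingHom.id_apply, mkO_smul, mkO_eq_iff]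
        filter_upwards [hf.eventually_analyticAt] with x h1
        simp only [pdi, Pi.smul_apply]
        rw [fderiv_const_smul h1.differentiableAt]
        rfl }
    (by
      intro a b
      obtain ⟨f, hf, rfl⟩ := exists_mkO a
      obtain ⟨g, hg, rfl⟩ := exists_mkO b
      simp only [LinearMap.coe_mk, AddHom.coe_mk, smul_eq_mul]
      rw [mkO_mul, dFun_mkO, dFun_mkO, dFun_mkO, mkO_mul, mkO_mul, mkO_add, mkO_eq_iff]
      filter_upwards [hf.eventually_analyticAt, hg.eventually_analyticAt] with x h1 h2
      simp only [pdi, Pi.add_apply, Pi.mul_apply]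
      rw [fderiv_mul h1.differentiableAt h2.differentiableAt]
      rfl)

theorem dO_mkO {n : ℕ} (i : Fin n) {f : (Fin n → ℂ) → ℂ} (hf : AnalyticAt ℂ f 0) :
    dO n i (mkO n f hf) = mkO n (pdi n i f) (pdi_analyticAt i hf) := dFun_mkO i hf

theorem dO_comm {n : ℕ} (i j : Fin n) (g : O0 n) : dO n i (dO n j g) = dO n j (dO n i g) := by
  obtain ⟨f, hf, rfl⟩ := exists_mkO g
  rw [dO_mkO, dO_mkO, dO_mkO, dO_mkO, mkO_eq_iff]
  filter_upwards [hf.eventually_analyticAt] with x h1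
  exact pdi_comm i j h1

theorem coord_analyticAt {n : ℕ} (i : Fin n) :
    AnalyticAt ℂ (fun t : Fin n → ℂ => t i) 0 :=
  (ContinuousLinearMap.proj (R := ℂ) (φ := fun _ : Fin n => ℂ) i).analyticAt 0

/-- The coordinate germs. -/
def tO (n : ℕ) (i : Fin n) : O0 n := mkO n (fun t => t i) (coord_analyticAt i)

theorem tO_mem {n : ℕ} (i : Fin n) : tO n i ∈ Mideal n := mem_Mideal.2 rfl

theorem dO_tO {n : ℕ} (i j : Fin n) : dO n i (tO n j) = if i = j then 1 else 0 := by
  have h : ∀ x : Fin n → ℂ, pdi n i (fun t => t j) x = if i = j then 1 else 0 := by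
    intro x
    have : fderiv ℂ (fun t : Fin n → ℂ => t j) x
        = ContinuousLinearMap.proj (R := ℂ) (φ := fun _ : Fin n => ℂ) j :=
      (ContinuousLinearMap.proj (R := ℂ) (φ := fun _ : Fin n => ℂ) j).fderiv
    simp [pdi, this, Pi.single_apply, eq_comm]
  rw [tO, dO_mkO]
  split_ifs with hij
  · rw [mkO_one, mkO_eq_iff]
    exact Eventually.of_forall fun x => by rw [h, if_pos hij]
  · change _ = mkO n (fun _ => 0) analyticAt_const
    rw [mkO_eq_iff]
    exact Eventually.of_forall fun x => by rw [h, if_neg hij]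

theorem hadamard_fun {V : Type*} [NormedAddCommGroup V] [NormedSpace ℂ V] [CompleteSpace V]
    {f : V → ℂ} (hf : AnalyticAt ℂ f 0) :
    ∃ G : V → (V →L[ℂ] ℂ), AnalyticAt ℂ G 0 ∧ ∀ᶠ t in 𝓝 0, f t = f 0 + G t t := by
  obtain ⟨p, r, hp⟩ := hf
  have hr : 0 < p.shift.radius := by
    rw [p.radius_shift]; exact hp.r_pos.trans_le hp.r_le
  have hG := p.shift.hasFPowerSeriesOnBall hr
  refine ⟨p.shift.sum, hG.analyticAt, ?_⟩
  have h2 := hG.unshift (z := f 0)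
  have he : p.shift.unshift (f 0) = p := by
    ext m v
    cases m with
    | zero =>
      have := hp.coeff_zero v
      rw [this]; rfl
    | succ m =>
      simp [FormalMultilinearSeries.unshift, FormalMultilinearSeries.shift]
  rw [he] at h2
  have hq := hp.mono h2.r_pos
  have h3 : HasFPowerSeriesAt f p 0 := hp.hasFPowerSeriesAt
  have h4 := h2.hasFPowerSeriesAt
  filter_upwards [h3.eventually_hasSum, h4.eventually_hasSum] with t a b
  have := a.unique b
  simpa using this

theorem hadamard {n : ℕ} (g : O0 n) (hg : g ∈ Mideal n) :
    ∃ h : Fin n → O0 n, g = ∑ i, tO n i * h i := by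
  obtain ⟨f, hf, rfl⟩ := exists_mkO g
  have hf0 : f 0 = 0 := mem_Mideal.1 hg
  obtain ⟨G, hG, hfG⟩ := hadamard_fun hf
  have hGi : ∀ i : Fin n, AnalyticAt ℂ (fun t => G t (Pi.single i 1)) 0 := fun i =>
    ((ContinuousLinearMap.apply ℂ ℂ (Pi.single i (1 : ℂ) : Fin n → ℂ)).analyticAt _).comp hG
  refine ⟨fun i => mkO n _ (hGi i), ?_⟩
  have hsum : ∀ s : Finset (Fin n), ∃ hh : AnalyticAt ℂ
      (fun t : Fin n → ℂ => ∑ i ∈ s, t i * G t (Pi.single i 1)) 0,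
      ∑ i ∈ s, tO n i * mkO n _ (hGi i) = mkO n _ hh := by
    intro s
    classical
    induction s using Finset.induction_on with
    | empty => exact ⟨by simpa using analyticAt_const, rfl⟩
    | insert a s ha ih =>
      obtain ⟨hh, e⟩ := ih
      have hh2 : AnalyticAt ℂ (fun t : Fin n → ℂ =>
          ∑ i ∈ insert a s, t i * G t (Pi.single i 1)) 0 := by
        simp only [Finset.sum_insert ha]
        exact ((coord_analyticAt a).mul (hGi a)).add hh
      refine ⟨hh2, ?_⟩
      rw [Finset.sum_insert ha, e, tO, mkO_mul, mkO_add, mkO_eq_iff]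
      exact Eventually.of_forall fun t => by simp [Finset.sum_insert ha]
  obtain ⟨hh, e⟩ := hsum Finset.univ
  rw [e, mkO_eq_iff]
  filter_upwards [hfG] with t ht
  rw [ht, hf0, zero_add]
  have hs := (G t).toLinearMap.pi_apply_eq_sum_univ t
  refine hs.trans (Finset.sum_congr rfl fun i _ => ?_)
  have he : (fun j => if i = j then (1 : ℂ) else 0) = Pi.single i 1 := by
    funext j
    simp [Pi.single_apply, eq_comm]
  rw [he, smul_eq_mul]
  rfl

/-- The Euler derivation `Σ t_i ∂_i` of `O₀`. -/
def eulerO (n : ℕ) : Derivation ℂ (O0 n) (O0 n) := ∑ i, tO n i • dO n i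

theorem eulerO_apply {n : ℕ} (g : O0 n) : eulerO n g = ∑ i, tO n i * dO n i g := by
  rw [eulerO, ← Derivation.coeFnAddMonoidHom_apply, map_sum, Finset.sum_apply]
  rfl

theorem eulerO_mem {n : ℕ} (g : O0 n) : eulerO n g ∈ Mideal n := by
  rw [eulerO_apply]
  exact Ideal.sum_mem _ fun i _ => Ideal.mul_mem_right _ _ (tO_mem i)

theorem eulerO_tO {n : ℕ} (i : Fin n) : eulerO n (tO n i) = tO n i := by
  rw [eulerO_apply, Finset.sum_eq_single i]
  · rw [dO_tO, if_pos rfl, mul_one]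
  · intro j _ hj
    rw [dO_tO, if_neg hj, mul_zero]
  · simp

theorem eulerO_sub_mem {n : ℕ} {g : O0 n} (hg : g ∈ Mideal n) :
    eulerO n g - g ∈ Mideal n ^ 2 := by
  obtain ⟨h, rfl⟩ := hadamard g hg
  rw [map_sum, ← Finset.sum_sub_distrib]
  refine Ideal.sum_mem _ fun i _ => ?_
  rw [Derivation.leibniz, eulerO_tO, smul_eq_mul, smul_eq_mul, mul_comm (h i), add_sub_cancel_right,
    pow_two]
  exact Ideal.mul_mem_mul (tO_mem i) (eulerO_mem _)

theorem eulerO_pow {n : ℕ} (j : ℕ) : ∀ g ∈ Mideal n ^ j,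
    eulerO n g - (j : O0 n) * g ∈ Mideal n ^ (j + 1) := by
  induction j with
  | zero =>
    intro g _
    simpa using eulerO_mem g
  | succ j ih =>
    intro g hg
    rw [pow_succ] at hg
    refine Submodule.mul_induction_on hg ?_ ?_
    · intro a ha m hm
      have e : eulerO n (a * m) - ((j + 1 : ℕ) : O0 n) * (a * m)
          = a * (eulerO n m - m) + (eulerO n a - (j : O0 n) * a) * m := by
        rw [Derivation.leibniz, smul_eq_mul, smul_eq_mul]
        push_cast
        ring
      rw [e]
      refine Ideal.add_mem _ ?_ ?_
      · have := Ideal.mul_mem_mul ha (eulerO_sub_mem hm)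
        rwa [← pow_add] at this
      · rw [pow_succ]
        exact Ideal.mul_mem_mul (ih a ha) hm
    · intro a b ha hb
      have e : eulerO n (a + b) - ((j + 1 : ℕ) : O0 n) * (a + b)
          = (eulerO n a - ((j + 1 : ℕ) : O0 n) * a)
            + (eulerO n b - ((j + 1 : ℕ) : O0 n) * b) := by
        rw [map_add]; ring
      rw [e]
      exact Ideal.add_mem _ ha hb

theorem mem_pow_of_deriv {n k : ℕ} {g : O0 n} (h0 : g ∈ Mideal n)
    (hd : ∀ i, dO n i g ∈ Mideal n ^ k) : g ∈ Mideal n ^ (k + 1) := by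
  have hE : eulerO n g ∈ Mideal n ^ (k + 1) := by
    rw [eulerO_apply, pow_succ']
    exact Ideal.sum_mem _ fun i _ => Ideal.mul_mem_mul (tO_mem i) (hd i)
  have key : ∀ j, j ≤ k → g ∈ Mideal n ^ (j + 1) := by
    intro j
    induction j with
    | zero => intro _; simpa using h0
    | succ j ih =>
      intro hj
      have h1 := eulerO_pow (j + 1) g (ih (by omega))
      have h2 : eulerO n g ∈ Mideal n ^ (j + 1 + 1) := Ideal.pow_le_pow_right (by omega) hE
      have h3 := Ideal.sub_mem _ h2 h1
      rw [sub_sub_cancel] at h3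
      have h4 := Ideal.mul_mem_left _ (algebraMap ℂ (O0 n) (((j + 1 : ℕ) : ℂ)⁻¹)) h3
      rw [← mul_assoc, ← map_natCast (algebraMap ℂ (O0 n)) (j + 1), ← map_mul,
        inv_mul_cancel₀ (Nat.cast_ne_zero.2 (Nat.succ_ne_zero j)), map_one, one_mul] at h4
      exact h4
  exact key k le_rfl

/-- The iterated derivative on `O₀` along a list of coordinates. -/
def dList (n : ℕ) (l : List (Fin n)) (α : Fin n → ℕ) (g : O0 n) : O0 n :=
  l.foldr (fun i g => (dO n i)^[α i] g) g

theorem dList_cons {n : ℕ} (i : Fin n) (l : List (Fin n)) (α : Fin n → ℕ) (g : O0 n) :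
    dList n (i :: l) α g = (dO n i)^[α i] (dList n l α g) := rfl

theorem dO_dList {n : ℕ} (j : Fin n) (l : List (Fin n)) (α : Fin n → ℕ) (g : O0 n) :
    dO n j (dList n l α g) = dList n l α (dO n j g) := by
  induction l with
  | nil => rfl
  | cons i l ih =>
    rw [dList_cons, dList_cons, ← ih]
    have hc : Function.Commute (dO n j) (dO n i) := fun x => dO_comm j i x
    exact hc.iterate_right (α i) _

theorem dList_congr {n : ℕ} (l : List (Fin n)) (α β : Fin n → ℕ) (h : ∀ i ∈ l, α i = β i)
    (g : O0 n) : dList n l α g = dList n l β g := by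
  induction l with
  | nil => rfl
  | cons i l ih =>
    rw [dList_cons, dList_cons, ih (fun a ha => h a (List.mem_cons_of_mem _ ha)),
      h i List.mem_cons_self]

theorem dList_succ {n : ℕ} (j : Fin n) (l : List (Fin n)) (hl : l.Nodup) (hj : j ∈ l)
    (α β : Fin n → ℕ) (h1 : β j = α j + 1) (h2 : ∀ i, i ≠ j → β i = α i)
    (g : O0 n) : dList n l β g = dList n l α (dO n j g) := by
  induction l with
  | nil => simp at hj
  | cons i l ih =>
    rw [List.nodup_cons] at hl
    rw [dList_cons, dList_cons]
    by_cases hij : i = j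
    · subst hij
      rw [h1, Function.iterate_succ_apply, dO_dList]
      rw [dList_congr l β α fun a ha => h2 a fun e => hl.1 (e ▸ ha)]
    · rw [h2 i hij, ih hl.2 ((List.mem_cons.1 hj).resolve_left (Ne.symm hij))]

/-- `∂^α` on `O₀` as a linear map. -/
def dAlpha (n : ℕ) (α : Fin n →₀ ℕ) : O0 n →ₗ[ℂ] O0 n where
  toFun := dList n (List.finRange n) α
  map_add' a b := by
    induction List.finRange n with
    | nil => rfl
    | cons i l ih => rw [dList_cons, ih, dList_cons, dList_cons, iterate_map_add]
  map_smul' c a := by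
    induction List.finRange n with
    | nil => rfl
    | cons i l ih =>
      rw [dList_cons, ih, dList_cons]
      induction α i with
      | zero => rfl
      | succ k ihk =>
        rw [Function.iterate_succ_apply', ihk, Function.iterate_succ_apply']
        exact (dO n i).map_smul c _

theorem evL_dAlpha_mkO {n : ℕ} (α : Fin n →₀ ℕ) {f : (Fin n → ℂ) → ℂ} (hf : AnalyticAt ℂ f 0) :
    evL n (dAlpha n α (mkO n f hf)) = pdMulti n α f 0 := by
  have hit : ∀ (i : Fin n) (k : ℕ) (f : (Fin n → ℂ) → ℂ) (hf : AnalyticAt ℂ f 0),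
      ∃ hh : AnalyticAt ℂ ((pdi n i)^[k] f) 0, (dO n i)^[k] (mkO n f hf) = mkO n _ hh := by
    intro i k f hf
    induction k with
    | zero => exact ⟨hf, rfl⟩
    | succ k ih =>
      obtain ⟨hh, e⟩ := ih
      simp only [Function.iterate_succ_apply']
      exact ⟨pdi_analyticAt i hh, by rw [e, dO_mkO]⟩
  have hl : ∀ l : List (Fin n), ∃ hh : AnalyticAt ℂ
      (l.foldr (fun i g => (pdi n i)^[α i] g) f) 0, dList n l α (mkO n f hf) = mkO n _ hh := by
    intro l
    induction l with
    | nil => exact ⟨hf, rfl⟩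
    | cons i l ih =>
      obtain ⟨hh, e⟩ := ih
      obtain ⟨hh2, e2⟩ := hit i (α i) _ hh
      exact ⟨hh2, by rw [dList_cons, e, e2]; rfl⟩
  obtain ⟨hh, e⟩ := hl (List.finRange n)
  change evalO0 n (dList n (List.finRange n) α (mkO n f hf)) = _
  rw [e]
  rfl

theorem pdMulti_shift {n : ℕ} (α : Fin n →₀ ℕ) (f : (Fin n → ℂ) → ℂ) (μ : Fin n → ℂ) :
    pdMulti n α (fun t => f (μ + t)) 0 = pdMulti n α f μ := by
  have hit : ∀ (i : Fin n) (k : ℕ) (f : (Fin n → ℂ) → ℂ),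
      (pdi n i)^[k] (fun t => f (μ + t)) = fun t => (pdi n i)^[k] f (μ + t) := by
    intro i k f
    induction k with
    | zero => rfl
    | succ k ih =>
      rw [Function.iterate_succ_apply', ih, Function.iterate_succ_apply']
      funext t
      simp only [pdi]
      rw [fderiv_comp_add_left]
  have hl : ∀ l : List (Fin n), l.foldr (fun i g => (pdi n i)^[α i] g) (fun t => f (μ + t))
      = fun t => l.foldr (fun i g => (pdi n i)^[α i] g) f (μ + t) := by
    intro l
    induction l with
    | nil => rfl
    | cons i l ih => rw [List.foldr_cons, ih, hit]; rfl
  simp only [pdMulti, hl, add_zero]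

theorem dAlpha_add_single {n : ℕ} (α : Fin n →₀ ℕ) (i : Fin n) (g : O0 n) :
    dAlpha n (α + Finsupp.single i 1) g = dAlpha n α (dO n i g) := by
  refine dList_succ i _ (List.nodup_finRange n) (List.mem_finRange i) _ _ ?_ ?_ g
  · simp
  · intro j hj
    simp [Ne.symm hj]

theorem mem_pow_of_dAlpha {n : ℕ} (k : ℕ) : ∀ g : O0 n,
    (∀ α : Fin n →₀ ℕ, α.degree < k → evL n (dAlpha n α g) = 0) → g ∈ Mideal n ^ k := by
  induction k with
  | zero => intro g _; simp
  | succ k ih =>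
    intro g hg
    refine mem_pow_of_deriv ?_ fun i => ih _ fun α hα => ?_
    · have h0 : dAlpha n 0 g = g := by
        change dList n _ _ g = g
        induction List.finRange n with
        | nil => rfl
        | cons i l ih => rw [dList_cons, ih]; rfl
      have := hg 0 (by simp)
      rw [h0] at this
      exact mem_Mideal.2 this
    · rw [← dAlpha_add_single]
      exact hg _ (by simpa using hα)

theorem exists_pow_kill (n : ℕ) (E : Type*) [AddCommGroup E] [Module ℂ E] [Module (O0 n) E]
    [IsScalarTower ℂ (O0 n) E] [FiniteDimensional ℂ E] :
    ∃ k : ℕ, ∀ g ∈ Mideal n ^ k, ∀ e : E, g • e = 0 := by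
  have : IsArtinian (O0 n) E := isArtinian_of_tower ℂ inferInstance
  have : IsNoetherian (O0 n) E := isNoetherian_of_tower ℂ inferInstance
  let F : ℕ →o (Submodule (O0 n) E)ᵒᵈ :=
    { toFun := fun k => OrderDual.toDual (Mideal n ^ k • (⊤ : Submodule (O0 n) E))
      monotone' := fun a b hab =>
        OrderDual.toDual_le_toDual.2 (Submodule.smul_mono_left (Ideal.pow_le_pow_right hab)) }
  obtain ⟨k, hk⟩ := IsArtinian.monotone_stabilizes F
  have h1 : Mideal n ^ k • (⊤ : Submodule (O0 n) E) = Mideal n ^ (k + 1) • ⊤ :=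
    hk (k + 1) (Nat.le_succ k)
  have h2 : Mideal n ^ k • (⊤ : Submodule (O0 n) E) = ⊥ := by
    refine Submodule.eq_bot_of_le_smul_of_le_jacobson_bot (Mideal n) _
      (IsNoetherian.noetherian _) ?_ (Mideal_le_jacobson n)
    conv_lhs => rw [h1]
    rw [pow_succ', Submodule.mul_smul]
  refine ⟨k, fun g hg e => ?_⟩
  have := Submodule.smul_mem_smul hg (Submodule.mem_top : e ∈ (⊤ : Submodule (O0 n) E))
  rw [h2] at this
  exact (Submodule.mem_bot _).1 this

set_option synthInstance.maxHeartbeats 1000000 in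
/-- Let `E` be an `O₀`-module, finite-dimensional over `ℂ` (with compatible
`ℂ`-action).  For every `ℂ`-linear functional `η` on `End_ℂ(E)` there is a finitely supported
family `c` of complex numbers indexed by multi-indices such that for every open `Ω ⊆ ℂⁿ`,
every `f : ℂⁿ → ℂ` analytic at each point of `Ω`, and every `μ ∈ Ω`:
`η(f^{(E)}(μ)) = Σ_α c_α (∂^α f)(μ)`. -/
theorem dual_of_End_as_differential_operator (n : ℕ) (hn : 1 ≤ n) (E : Type*)
    [AddCommGroup E] [Module ℂ E] [Module (O0 n) E] [IsScalarTower ℂ (O0 n) E]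
    [FiniteDimensional ℂ E] (η : Module.End ℂ E →ₗ[ℂ] ℂ) :
    ∃ c : (Fin n →₀ ℕ) →₀ ℂ, ∀ (Ω : Set (Fin n → ℂ)), IsOpen Ω →
      ∀ f : (Fin n → ℂ) → ℂ, ∀ hf : (∀ x ∈ Ω, AnalyticAt ℂ f x), ∀ μ, ∀ hμ : μ ∈ Ω,
        η (fE n E μ f (hf μ hμ)) = c.sum fun α cα => cα * pdMulti n α f μ := by
  obtain ⟨k, hk⟩ := exists_pow_kill n E
  let ψ : O0 n →ₗ[ℂ] ℂ :=
    { toFun := fun g => η (Algebra.lsmul ℂ ℂ E g)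
      map_add' := fun a b => by rw [map_add, map_add]
      map_smul' := fun c a => by rw [map_smul, map_smul, RingHom.id_apply] }
  let B : Finset (Fin n →₀ ℕ) := Finset.Iic (Finsupp.equivFunOnFinite.symm fun _ => k)
  let L : B → (O0 n →ₗ[ℂ] ℂ) := fun α => (evL n).comp (dAlpha n α.1)
  have hker : ⨅ α, LinearMap.ker (L α) ≤ LinearMap.ker ψ := by
    intro g hg
    rw [Submodule.mem_iInf] at hg
    rw [LinearMap.mem_ker]
    have hg2 : g ∈ Mideal n ^ k := by
      refine mem_pow_of_dAlpha k g fun α hα => ?_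
      have hαB : α ∈ B := by
        refine Finset.mem_Iic.2 fun i => ?_
        exact (Finsupp.le_degree i α).trans hα.le
      exact hg ⟨α, hαB⟩
    have : Algebra.lsmul ℂ ℂ E g = 0 := by
      ext e
      exact hk g hg2 e
    change η (Algebra.lsmul ℂ ℂ E g) = 0
    rw [this, map_zero]
  obtain ⟨c, hc⟩ := (Submodule.mem_span_range_iff_exists_fun ℂ).1
    (mem_span_of_iInf_ker_le_ker hker)
  refine ⟨Finsupp.onFinset B (fun α => if h : α ∈ B then c ⟨α, h⟩ else 0) ?_, ?_⟩
  · intro α h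
    by_contra h'
    exact h (dif_neg h')
  intro Ω _ f hf μ hμ
  have hψ : η (fE n E μ f (hf μ hμ)) = ψ (shiftGerm n μ f (hf μ hμ)) := rfl
  rw [hψ, ← hc, Finsupp.onFinset_sum _ (fun _ => zero_mul _), ← Finset.sum_coe_sort B,
    LinearMap.sum_apply]
  refine Finset.sum_congr rfl fun α _ => ?_
  rw [dif_pos α.2, LinearMap.smul_apply, smul_eq_mul]
  congr 1
  rw [← pdMulti_shift]
  have hs : AnalyticAt ℂ (fun t => f (μ + t)) 0 := by
    have h2 : AnalyticAt ℂ f (μ + 0) := by simpa using hf μ hμ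
    exact h2.comp (f := fun t => μ + t) (analyticAt_const.add analyticAt_id)
  exact evL_dAlpha_mkO α.1 hs

end PaleyWiener
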